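/- For every integer n ≥ 1 and every integer j with 0 ≤ j ≤ 3n, the rational number A_j(n) is an integer, and moreover 2^{⌊(5n+3j)/2⌋−1}·5^j divides A_j(n). -/

import Mathlib

/-- `A j n`: the Laurent coefficient of `(x+5)^{-(j+1)}` of `R_n` at `x = -5`, i.e.
`(1/(3n-j)!) (d/dx)^{3n-j} [(x+5)^{3n+1} R_n(x)]` at `x = -5`, where
`(x+5)^{3n+1} R_n(x) = 5 x^{2n} (x⁴+6x²+25)^{2n} / (5-x)^{3n+1}`. -/
noncomputable def A (n : ℕ) (j : ℤ) : ℂ :=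
  (1 / ((3 * (n : ℤ) - j).toNat.factorial : ℂ)) *
    iteratedDeriv (3 * (n : ℤ) - j).toNat
      (fun x : ℂ =>
        5 * x ^ (2 * n) * (x ^ 4 + 6 * x ^ 2 + 25) ^ (2 * n) / (5 - x) ^ (3 * n + 1))
      (-5)

/-- `f` is analytic at `0` and its `k`-th Taylor coefficient there is an integer divisible by
`2 ^ ⌈(w - k) / 2⌉`. This is the filtration of `ℤ⟦u⟧` in which `u` has weight `1` and `2` has
weight `2`. -/
def HasTaylorWeight (w : ℕ) (f : ℂ → ℂ) : Prop :=
  AnalyticAt ℂ f 0 ∧ ∀ k, ∃ m : ℤ,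
    iteratedDeriv k f 0 = k.factorial * (2 ^ ((w - k + 1) / 2) * m : ℤ)

namespace HasTaylorWeight

variable {v w : ℕ} {f g : ℂ → ℂ}

theorem mono (hf : HasTaylorWeight w f) (h : v ≤ w) : HasTaylorWeight v f := by
  refine ⟨hf.1, fun k => ?_⟩
  obtain ⟨m, hm⟩ := hf.2 k
  obtain ⟨c, hc⟩ := pow_dvd_pow (2 : ℤ) (show (v - k + 1) / 2 ≤ (w - k + 1) / 2 by omega)
  exact ⟨c * m, by rw [hm, hc, mul_assoc]⟩

theorem add (hf : HasTaylorWeight w f) (hg : HasTaylorWeight w g) :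
    HasTaylorWeight w (f + g) := by
  refine ⟨hf.1.add hg.1, fun k => ?_⟩
  obtain ⟨a, ha⟩ := hf.2 k
  obtain ⟨b, hb⟩ := hg.2 k
  refine ⟨a + b, ?_⟩
  rw [iteratedDeriv_add hf.1.contDiffAt hg.1.contDiffAt, ha, hb]
  push_cast
  ring

theorem mul (hf : HasTaylorWeight v f) (hg : HasTaylorWeight w g) :
    HasTaylorWeight (v + w) (f * g) := by
  refine ⟨hf.1.mul hg.1, fun k => ?_⟩
  choose a ha using hf.2
  choose b hb using hg.2
  have hdvd : (2 : ℤ) ^ ((v + w - k + 1) / 2) ∣ ∑ i ∈ Finset.range (k + 1),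
      (2 ^ ((v - i + 1) / 2) * a i) * (2 ^ ((w - (k - i) + 1) / 2) * b (k - i)) := by
    refine Finset.dvd_sum fun i hi => ?_
    have hik : i ≤ k := Nat.lt_succ_iff.mp (Finset.mem_range.mp hi)
    rw [mul_mul_mul_comm, ← pow_add]
    exact (pow_dvd_pow 2 (by omega)).mul_right _
  obtain ⟨m, hm⟩ := hdvd
  refine ⟨m, ?_⟩
  rw [iteratedDeriv_mul hf.1.contDiffAt hg.1.contDiffAt, ← hm, Int.cast_sum, Finset.mul_sum]
  refine Finset.sum_congr rfl fun i hi => ?_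
  have hik : i ≤ k := Nat.lt_succ_iff.mp (Finset.mem_range.mp hi)
  rw [ha, hb, ← Nat.choose_mul_factorial_mul_factorial hik]
  push_cast
  ring

theorem const {c : ℤ} (hc : (2 : ℤ) ^ ((w + 1) / 2) ∣ c) :
    HasTaylorWeight w (fun _ => (c : ℂ)) := by
  refine ⟨analyticAt_const, fun k => ?_⟩
  obtain ⟨m, rfl⟩ := hc
  rcases k with _ | k
  · exact ⟨m, by simp⟩
  · exact ⟨0, by simp [iteratedDeriv_const]⟩

theorem id : HasTaylorWeight 1 (fun u => u) := by
  refine ⟨analyticAt_id, fun k => ?_⟩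
  rw [iteratedDeriv_fun_id_zero]
  split_ifs with hk
  · subst hk
    exact ⟨1, by simp⟩
  · exact ⟨0, by simp⟩

theorem inv_one_sub : HasTaylorWeight 0 (fun u => (1 - u)⁻¹) := by
  refine ⟨(analyticAt_const.sub analyticAt_id).inv (by simp), fun k => ⟨1, ?_⟩⟩
  have h := congrFun (iter_deriv_inv_linear k (-1 : ℂ) 1) 0
  rw [← iteratedDeriv_eq_iterate] at h
  have e : (fun u : ℂ => (1 - u)⁻¹) = fun u => (-1 * u + 1)⁻¹ := by
    funext u
    ring
  have hs : (-1 : ℂ) ^ k * (-1) ^ k = 1 := by rw [← mul_pow]; simp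
  rw [e, h]
  simp only [mul_zero, zero_add, one_zpow, mul_one]
  rw [mul_right_comm, hs]
  simp

theorem pow (hf : HasTaylorWeight w f) (n : ℕ) : HasTaylorWeight (n * w) (f ^ n) := by
  induction n with
  | zero => simpa [Pi.one_def] using const (w := 0) (c := 1) (by simp)
  | succ n ih => rw [Nat.succ_mul, pow_succ]; exact ih.mul hf

end HasTaylorWeight

theorem hasTaylorWeight_quartic :
    HasTaylorWeight 2 (fun u => 2 - 14 * u + 39 * u ^ 2 - 50 * u ^ 3 + 25 * u ^ 4) := by
  have c (m : ℤ) : HasTaylorWeight 0 (fun _ => (m : ℂ)) := .const (by simp)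
  have hu := HasTaylorWeight.id
  have hu₀ := hu.mono (Nat.zero_le 1)
  have h2 : HasTaylorWeight 2 (fun _ => ((2 : ℤ) : ℂ)) := .const (by norm_num)
  have h₁ := (c 1).add (((c (-7)).mul hu₀).mono (Nat.zero_le _))
  have h₂ := (c (-50)).add (((c 25).mul hu₀).mono (Nat.zero_le _))
  have h₃ := (c 39).add ((hu₀.mul h₂).mono (Nat.zero_le _))
  have h := ((h2.mul h₁).mono (Nat.le_add_right 2 0)).add
    (((hu.mul hu).mul h₃).mono (Nat.le_add_right 2 0))
  refine Eq.subst (motive := HasTaylorWeight 2) (funext fun u => ?_) h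
  simp only [Pi.add_apply, Pi.mul_apply]
  push_cast
  ring

theorem hasTaylorWeight_rescaled (n : ℕ) :
    HasTaylorWeight (4 * n) (fun u => (2 * u - 1) ^ (2 * n) *
      (2 - 14 * u + 39 * u ^ 2 - 50 * u ^ 3 + 25 * u ^ 4) ^ (2 * n) *
      (1 - u)⁻¹ ^ (3 * n + 1)) := by
  have c (m : ℤ) : HasTaylorWeight 0 (fun _ => (m : ℂ)) := .const (by simp)
  have hlin := ((c 2).mul (HasTaylorWeight.id.mono (Nat.zero_le 1))).add (c (-1))
  have h := ((hlin.pow (2 * n)).mul (hasTaylorWeight_quartic.pow (2 * n))).mul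
    (HasTaylorWeight.inv_one_sub.pow (3 * n + 1))
  refine Eq.subst (motive := HasTaylorWeight (4 * n)) (funext fun u => ?_)
    (h.mono (by omega))
  simp only [Pi.add_apply, Pi.mul_apply, Pi.pow_apply]
  push_cast
  ring

theorem iteratedDeriv_comp_mul_left (k : ℕ) (c x : ℂ) (f : ℂ → ℂ) :
    iteratedDeriv k (fun u => f (c * u)) x = c ^ k * iteratedDeriv k f (c * x) := by
  induction k generalizing x with
  | zero => simp
  | succ k ih =>
    rw [iteratedDeriv_succ, funext ih, deriv_const_mul_field, deriv_comp_mul_left c,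
      iteratedDeriv_succ]
    simp [pow_succ, mul_assoc]

theorem integrand_rescale (n : ℕ) (u : ℂ) :
    10 ^ (3 * n) * (5 * (-5 + 10 * u) ^ (2 * n) *
        ((-5 + 10 * u) ^ 4 + 6 * (-5 + 10 * u) ^ 2 + 25) ^ (2 * n) /
        (5 - (-5 + 10 * u)) ^ (3 * n + 1)) * 2 =
      5 ^ (6 * n) * 2 ^ (8 * n) * ((2 * u - 1) ^ (2 * n) *
        (2 - 14 * u + 39 * u ^ 2 - 50 * u ^ 3 + 25 * u ^ 4) ^ (2 * n) *
        (1 - u)⁻¹ ^ (3 * n + 1)) := by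
  have h₁ : -5 + 10 * u = 5 * (2 * u - 1) := by ring
  have h₂ : (-5 + 10 * u) ^ 4 + 6 * (-5 + 10 * u) ^ 2 + 25 =
      5 ^ 2 * 2 ^ 4 * (2 - 14 * u + 39 * u ^ 2 - 50 * u ^ 3 + 25 * u ^ 4) := by ring
  have h₃ : 5 - (-5 + 10 * u) = 10 * (1 - u) := by ring
  have e₅ : (5 : ℂ) ^ (6 * n) = 5 ^ (2 * n) * (5 ^ 2) ^ (2 * n) := by
    rw [← pow_mul, ← pow_add]; congr 1; ring
  have e₂ : (2 : ℂ) ^ (8 * n) = (2 ^ 4) ^ (2 * n) := by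
    rw [← pow_mul]; congr 1; ring
  have h10 : (10 : ℂ) ^ (3 * n) ≠ 0 := pow_ne_zero _ (by norm_num)
  have hcancel : (10 : ℂ) ^ (3 * n) * (10 ^ (3 * n) * 10)⁻¹ = 10⁻¹ := by
    rw [mul_inv, mul_inv_cancel_left₀ h10]
  rw [h₂, h₃, h₁, e₅, e₂, div_eq_mul_inv, mul_pow, mul_pow (5 ^ 2 * 2 ^ 4 : ℂ), mul_pow (5 ^ 2 : ℂ),
    mul_pow (10 : ℂ), mul_inv, ← inv_pow (1 - u), pow_succ (10 : ℂ)]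
  linear_combination (10 * 5 ^ (2 * n) * (2 * u - 1) ^ (2 * n) * (5 ^ 2) ^ (2 * n) *
    (2 ^ 4) ^ (2 * n) * (2 - 14 * u + 39 * u ^ 2 - 50 * u ^ 3 + 25 * u ^ 4) ^ (2 * n) *
    (1 - u)⁻¹ ^ (3 * n + 1)) * hcancel

/-- For `n ≥ 1` and `0 ≤ j ≤ 3n`, the Laurent coefficient `A_j(n)` is an integer divisible
by `2^{⌊(5n+3j)/2⌋ - 1} · 5^j`. -/
theorem A_integrality (n : ℕ) (hn : 1 ≤ n) (j : ℕ) (hj : j ≤ 3 * n) :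
    ∃ m : ℤ, A n (j : ℤ) = ((2 ^ ((5 * n + 3 * j) / 2 - 1) * 5 ^ j * m : ℤ) : ℂ) := by
  obtain ⟨k, hk⟩ : ∃ k, 3 * n = k + j := ⟨3 * n - j, by omega⟩
  have hk' : (3 * (n : ℤ) - j).toNat = k := by omega
  obtain ⟨m, hm⟩ := (hasTaylorWeight_rescaled n).2 k
  have hf := congrArg (fun F : ℂ → ℂ => iteratedDeriv k F 0) (funext (integrand_rescale n))
  simp only [iteratedDeriv_mul_const_field, iteratedDeriv_const_mul_field, hm] at hf
  rw [A, hk']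
  set f : ℂ → ℂ := fun x =>
    5 * x ^ (2 * n) * (x ^ 4 + 6 * x ^ 2 + 25) ^ (2 * n) / (5 - x) ^ (3 * n + 1)
  have hD : iteratedDeriv k (fun u => f (-5 + 10 * u)) 0 = 10 ^ k * iteratedDeriv k f (-5) := by
    rw [iteratedDeriv_comp_mul_left k 10 0 (fun z => f (-5 + z)), iteratedDeriv_comp_const_add]
    simp
  change 10 ^ (3 * n) * iteratedDeriv k (fun u => f (-5 + 10 * u)) 0 * 2 = _ at hf
  rw [hD] at hf
  obtain ⟨c, hc⟩ : (2 : ℤ) ^ (3 * n + k + 1 + ((5 * n + 3 * j) / 2 - 1)) ∣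
      2 ^ (8 * n) * 2 ^ ((4 * n - k + 1) / 2) := by
    rw [← pow_add]
    exact pow_dvd_pow 2 (by omega)
  refine ⟨c * m, ?_⟩
  have hc' := congrArg (Int.cast : ℤ → ℂ) hc
  have hfac : (k.factorial : ℂ) ≠ 0 := Nat.cast_ne_zero.mpr k.factorial_ne_zero
  have h10 : (10 : ℂ) ^ (3 * n + k) * 2 ≠ 0 := by simp
  have e₅ : (5 : ℂ) ^ (6 * n) = 5 ^ (3 * n + k) * 5 ^ j := by
    rw [← pow_add]; congr 1; omega
  have e₁₀ : (10 : ℂ) ^ (3 * n + k) = 2 ^ (3 * n + k) * 5 ^ (3 * n + k) := by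
    rw [← mul_pow]; norm_num
  rw [one_div, inv_mul_eq_iff_eq_mul₀ hfac]
  apply mul_left_cancel₀ h10
  push_cast at hf hc' ⊢
  rw [e₅] at hf
  calc _ = 10 ^ (3 * n) * (10 ^ k * iteratedDeriv k f (-5)) * 2 := by rw [pow_add]; ring
    _ = _ := hf
    _ = 5 ^ (3 * n + k) * 5 ^ j * k.factorial * m *
        (2 ^ (8 * n) * 2 ^ ((4 * n - k + 1) / 2)) := by ring
    _ = _ := by rw [hc', e₁₀, pow_add _ (3 * n + k + 1), pow_succ]; ring
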